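/- For every integer d ≥ 2, the lattice graph L_d and the rooted regular tree T_{d²}^root of branching degree d² are cospectral: the adjacency operator A_d of L_d on ℓ²(ℤ^d, ℂ) is unitarily equivalent to the adjacency operator of T_{d²}^root on ℓ² of its vertex set. -/

import Mathlib

noncomputable section

open MeasureTheory Set Filter
open scoped ENNReal InnerProductSpace

section Abstract

variable {H K L : Type*} [NormedAddCommGroup H] [InnerProductSpace ℂ H]
  [NormedAddCommGroup K] [InnerProductSpace ℂ K] [NormedAddCommGroup L] [InnerProductSpace ℂ L]

/-- A (partially defined) operator, given by its graph `R`, embeds isometrically into another one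
with graph `S`. -/
def Embeds (R : H → H → Prop) (S : K → K → Prop) : Prop :=
  ∃ U : H →ₗᵢ[ℂ] K, ∀ x y, R x y → S (U x) (U y)

theorem Embeds.trans {R : H → H → Prop} {S : K → K → Prop} {T : L → L → Prop}
    (h : Embeds R S) (h' : Embeds S T) : Embeds R T := by
  obtain ⟨U, hU⟩ := h
  obtain ⟨V, hV⟩ := h'
  exact ⟨V.comp U, fun x y hxy => hV _ _ (hU _ _ hxy)⟩

variable [CompleteSpace H] [CompleteSpace K]

open ContinuousLinearMap in
/-- Cantor–Bernstein for self-adjoint operators up to unitary equivalence. -/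
theorem exists_unitary_of_embeds {X : H →L[ℂ] H} {Y : K →L[ℂ] K}
    (hX : adjoint X = X) (hY : adjoint Y = Y)
    (h : Embeds (fun x y => X x = y) (fun x y => Y x = y))
    (h' : Embeds (fun x y => Y x = y) (fun x y => X x = y)) :
    ∃ θ : H ≃ₗᵢ[ℂ] K, ∀ x, θ (X x) = Y (θ x) := by
  obtain ⟨U, hU⟩ := h
  obtain ⟨V, hV⟩ := h'
  replace hU : ∀ x, Y (U x) = U (X x) := fun x => hU x _ rfl
  replace hV : ∀ x, X (V x) = V (Y x) := fun x => hV x _ rfl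
  set U' : H →L[ℂ] K := U.toContinuousLinearMap with hU'
  set V' : K →L[ℂ] H := V.toContinuousLinearMap with hV'
  have hVV : ∀ k, adjoint V' (V k) = k := fun k => by
    refine ext_inner_right ℂ fun l => ?_
    rw [adjoint_inner_left]; exact V.inner_map_map k l
  have hVX : ∀ x, adjoint V' (X x) = Y (adjoint V' x) := fun x => by
    refine ext_inner_right ℂ fun l => ?_
    rw [adjoint_inner_left, ← hX, adjoint_inner_left, ← hY, adjoint_inner_left,
      adjoint_inner_left]
    exact congrArg _ (hV l)
  have hUX : ∀ x, adjoint U' (Y x) = X (adjoint U' x) := fun x => by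
    refine ext_inner_right ℂ fun l => ?_
    rw [adjoint_inner_left, ← hX, adjoint_inner_left, ← hY, adjoint_inner_left,
      adjoint_inner_left]
    exact congrArg _ (hU l)
  set C : H →L[ℂ] H := adjoint U' ∘L adjoint V' with hC
  have hCX : ∀ x, C (X x) = X (C x) := fun x => by simp [hC, hVX, hUX]
  have hclosed : IsClosed ((LinearMap.range V.toLinearMap : Submodule ℂ H) : Set H) := by
    have := V.isometry.isClosedEmbedding.isClosed_range
    convert this
    ext; simp
  let B : Submodule ℂ H := ⨅ n : ℕ, (LinearMap.range V.toLinearMap).comap (C ^ n).toLinearMap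
  have hB : ∀ x, x ∈ B ↔ ∀ n : ℕ, (C ^ n) x ∈ LinearMap.range V.toLinearMap := fun x => by
    simp only [B, Submodule.mem_iInf, Submodule.mem_comap]; rfl
  have hBclosed : IsClosed (B : Set H) := by
    have : (B : Set H) = ⋂ n : ℕ, (C ^ n) ⁻¹' (LinearMap.range V.toLinearMap : Submodule ℂ H) := by
      ext x; rw [SetLike.mem_coe, hB]; simp
    rw [this]
    exact isClosed_iInter fun n => hclosed.preimage (C ^ n).continuous
  have : CompleteSpace B := hBclosed.completeSpace_coe
  have hBC : ∀ x ∈ B, C x ∈ B := fun x hx => by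
    rw [hB] at hx ⊢
    intro n
    have := hx (n + 1)
    rwa [pow_succ] at this
  have hBX : ∀ x ∈ B, X x ∈ B := fun x hx => by
    rw [hB] at hx ⊢
    intro n
    have hcomm : (C ^ n) (X x) = X ((C ^ n) x) := by
      have : Commute C X := by ext x; exact hCX x
      exact congrArg (· x) (this.pow_left n)
    obtain ⟨k, hk⟩ := hx n
    rw [hcomm, ← hk]
    exact ⟨Y k, (hV k).symm⟩
  have hBV : ∀ x ∈ B, V (adjoint V' x) = x := fun x hx => by
    obtain ⟨k, hk⟩ : x ∈ LinearMap.range V.toLinearMap := by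
      have := (hB x).1 hx 0
      rwa [pow_zero] at this
    rw [← hk]; exact congrArg V (hVV k)
  have hAX : ∀ x ∈ Bᗮ, X x ∈ Bᗮ := fun x hx => by
    rw [Submodule.mem_orthogonal] at hx ⊢
    intro b hb
    rw [← hX, adjoint_inner_right]
    exact hx _ (hBX b hb)
  have horth : ∀ a ∈ Bᗮ, ∀ b ∈ B, ⟪U a, adjoint V' b⟫_ℂ = 0 := fun a ha b hb => by
    have h1 : ⟪U' a, adjoint V' b⟫_ℂ = ⟪a, C b⟫_ℂ := (adjoint_inner_right U' _ _).symm
    exact h1.trans ((Submodule.mem_orthogonal' _ _).1 ha _ (hBC b hb))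
  let θ : H →L[ℂ] K := U' ∘L Bᗮ.starProjection + adjoint V' ∘L B.starProjection
  have hθ : ∀ a ∈ Bᗮ, ∀ b ∈ B, θ (a + b) = U a + adjoint V' b := fun a ha b hb => by
    have h1 : Bᗮ.starProjection (a + b) = a := by
      rw [map_add, Submodule.starProjection_eq_self_iff.2 ha,
        (Submodule.starProjection_apply_eq_zero_iff Bᗮ).2, add_zero]
      exact B.le_orthogonal_orthogonal hb
    have h2 : B.starProjection (a + b) = b := by
      rw [map_add, Submodule.starProjection_eq_self_iff.2 hb,
        (Submodule.starProjection_apply_eq_zero_iff B).2 ha, zero_add]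
    simp [θ, h1, h2, hU']
  have hdec : ∀ x : H, ∃ a ∈ Bᗮ, ∃ b ∈ B, x = a + b := fun x => by
    obtain ⟨b, hb, a, ha, h⟩ := B.exists_add_mem_mem_orthogonal x
    exact ⟨a, ha, b, hb, by rw [h, add_comm]⟩
  have hnorm : ∀ x, ‖θ x‖ = ‖x‖ := fun x => by
    obtain ⟨a, ha, b, hb, rfl⟩ := hdec x
    have h1 : ‖adjoint V' b‖ = ‖b‖ := by
      rw [← V.norm_map, hBV b hb]
    rw [hθ a ha b hb, ← sq_eq_sq₀ (norm_nonneg _) (norm_nonneg _), sq, sq,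
      norm_add_sq_eq_norm_sq_add_norm_sq_of_inner_eq_zero _ _ (horth a ha b hb),
      norm_add_sq_eq_norm_sq_add_norm_sq_of_inner_eq_zero _ _
        ((Submodule.mem_orthogonal' _ _).1 ha b hb), h1, U.norm_map]
  let Θ : H →ₗᵢ[ℂ] K := ⟨θ.toLinearMap, hnorm⟩
  have hsurj : Function.Surjective Θ := by
    have hcl : IsClosed ((LinearMap.range Θ.toLinearMap : Submodule ℂ K) : Set K) := by
      have := Θ.isometry.isClosedEmbedding.isClosed_range
      convert this
      ext; simp
    have := hcl.completeSpace_coe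
    rw [← LinearIsometry.coe_toLinearMap, ← LinearMap.range_eq_top,
      ← Submodule.orthogonal_eq_bot_iff, Submodule.eq_bot_iff]
    intro k hk
    rw [Submodule.mem_orthogonal'] at hk
    have hkθ : ∀ x, ⟪k, θ x⟫_ℂ = 0 := fun x => hk _ ⟨x, rfl⟩
    have h1 : adjoint U' k ∈ B := by
      rw [← B.orthogonal_orthogonal, Submodule.mem_orthogonal']
      intro a ha
      rw [adjoint_inner_left]
      have := hkθ (a + 0)
      rwa [hθ a ha 0 B.zero_mem, map_zero, add_zero] at this
    have h2 : V k ∈ B := by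
      rw [hB]
      rintro (_ | n)
      · exact ⟨k, rfl⟩
      · have h3 : C (V k) = adjoint U' k := congrArg (adjoint U') (hVV k)
        rw [pow_succ]
        change (C ^ n) (C (V k)) ∈ _
        rw [h3]
        exact (hB _).1 h1 n
    have := hkθ (0 + V k)
    rw [hθ 0 (Submodule.zero_mem _) _ h2, map_zero, zero_add, hVV] at this
    exact inner_self_eq_zero.1 this
  refine ⟨LinearIsometryEquiv.ofSurjective Θ hsurj, fun x => ?_⟩
  change θ (X x) = Y (θ x)
  obtain ⟨a, ha, b, hb, rfl⟩ := hdec x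
  rw [map_add, hθ _ (hAX a ha) _ (hBX b hb), hθ a ha b hb, map_add, hU, hVX]

open ContinuousLinearMap in
/-- The isometric part in the polar decomposition of an injective intertwiner between
self-adjoint operators is an intertwiner. -/
theorem embeds_of_injective {X : H →L[ℂ] H} {Y : K →L[ℂ] K}
    (hX : adjoint X = X) (hY : adjoint Y = Y) {T : H →L[ℂ] K} (hT : Function.Injective T)
    (hXY : T ∘L X = Y ∘L T) : Embeds (fun x y => X x = y) (fun x y => Y x = y) := by
  set P : H →L[ℂ] H := adjoint T ∘L T with hP
  have hP0 : 0 ≤ P := by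
    rw [nonneg_iff_isPositive]
    exact isPositive_adjoint_comp_self T
  have hXY' : X ∘L adjoint T = adjoint T ∘L Y := by
    have := congrArg adjoint hXY
    rwa [adjoint_comp, adjoint_comp, hX, hY] at this
  have hPX : Commute P X := by
    change (adjoint T ∘L T) ∘L X = X ∘L (adjoint T ∘L T)
    rw [comp_assoc, hXY, ← comp_assoc, ← hXY', comp_assoc]
  set S : H →L[ℂ] H := CFC.sqrt P with hS
  have hSX : Commute S X := hPX.cfcₙ_nnreal NNReal.sqrt
  have hSS : S * S = P := CFC.sqrt_mul_sqrt_self P hP0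
  have hSadj : adjoint S = S := (CFC.sqrt_nonneg P).isSelfAdjoint
  have hnorm : ∀ x, ‖T x‖ = ‖S x‖ := fun x => by
    have h1 : ⟪T x, T x⟫_ℂ = ⟪S x, S x⟫_ℂ := by
      rw [← adjoint_inner_right T, ← adjoint_inner_right S, hSadj]
      exact congrArg (fun Z : H →L[ℂ] H => ⟪x, Z x⟫_ℂ) hSS.symm
    rw [inner_self_eq_norm_sq_to_K, inner_self_eq_norm_sq_to_K] at h1
    have h2 : ‖T x‖ ^ 2 = ‖S x‖ ^ 2 := by exact_mod_cast h1
    exact (sq_eq_sq₀ (norm_nonneg _) (norm_nonneg _)).1 h2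
  have hdense : DenseRange S := by
    have : (LinearMap.range S.toLinearMap).topologicalClosure = ⊤ := by
      rw [Submodule.topologicalClosure_eq_top_iff, Submodule.eq_bot_iff]
      intro x hx
      have h1 : S x = 0 := by
        rw [← inner_self_eq_zero (𝕜 := ℂ), ← adjoint_inner_right S, hSadj]
        exact (Submodule.mem_orthogonal' _ _).1 hx _ ⟨S x, rfl⟩
      apply hT
      rw [map_zero, ← norm_eq_zero, hnorm, h1, norm_zero]
    exact Submodule.dense_iff_topologicalClosure_eq_top.2 this
  have hbd : ∀ x, ‖T.toLinearMap x‖ ≤ 1 * ‖S.toLinearMap x‖ := fun x => by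
    rw [one_mul]; exact (hnorm x).le
  set W : H →L[ℂ] K := T.toLinearMap.extendOfNorm S.toLinearMap with hW
  have hWS : ∀ x, W (S x) = T x := fun x =>
    LinearMap.extendOfNorm_eq hdense ⟨1, hbd⟩ x
  refine ⟨⟨W.toLinearMap, fun x => ?_⟩, ?_⟩
  · refine hdense.induction (P := fun x => ‖W x‖ = ‖x‖) ?_ ?_ x
    · rintro _ ⟨x, rfl⟩
      rw [hWS, hnorm]
    · exact isClosed_eq (by fun_prop) (by fun_prop)
  · rintro x _ rfl
    change Y (W x) = W (X x)
    refine hdense.induction (P := fun x => Y (W x) = W (X x)) ?_ ?_ x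
    · rintro _ ⟨x, rfl⟩
      have h1 : X (S x) = S (X x) := congrArg (· x) hSX.symm.eq
      rw [h1, hWS, hWS]
      exact congrArg (· x) hXY.symm
    · exact isClosed_eq (by fun_prop) (by fun_prop)

end Abstract

section Sequence

open ContinuousLinearMap

local notation "ℓ²(" ι ")" => lp (fun _ : ι => ℂ) 2

variable {ι κ : Type*}

theorem memℓp_comp {σ : ι → κ} (hσ : Function.Injective σ) (ξ : ℓ²(κ)) :
    Memℓp (fun i => ξ (σ i)) 2 := by
  have h := (memℓp_gen_iff (by norm_num)).1 (lp.memℓp ξ)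
  exact (memℓp_gen_iff (by norm_num)).2 (h.comp_injective hσ)

/-- Precomposition with an injective map, as an operator on `ℓ²`. -/
def lpComp (σ : ι → κ) (hσ : Function.Injective σ) : ℓ²(κ) →L[ℂ] ℓ²(ι) :=
  LinearMap.mkContinuous
    { toFun := fun ξ => ⟨fun i => ξ (σ i), memℓp_comp hσ ξ⟩
      map_add' := fun _ _ => rfl
      map_smul' := fun _ _ => rfl } 1 fun ξ => by
    rw [one_mul]
    refine lp.norm_le_of_tsum_le (by norm_num) (norm_nonneg ξ) ?_
    rw [lp.norm_rpow_eq_tsum (by norm_num) ξ]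
    have h := (memℓp_gen_iff (by norm_num)).1 (lp.memℓp ξ)
    exact (h.comp_injective hσ).tsum_le_tsum_of_inj σ hσ (fun _ _ => by positivity)
      (fun _ => le_rfl) h

@[simp]
theorem lpComp_apply (σ : ι → κ) (hσ : Function.Injective σ) (ξ : ℓ²(κ)) (i : ι) :
    lpComp σ hσ ξ i = ξ (σ i) := rfl

theorem adjoint_lpComp_apply [DecidableEq κ] (σ : ι → κ) (hσ : Function.Injective σ) (ξ : ℓ²(ι))
    (i : ι) : adjoint (lpComp σ hσ) ξ (σ i) = ξ i := by
  classical
  have h : lpComp σ hσ (lp.single 2 (σ i) 1) = lp.single 2 i 1 := by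
    ext j
    simp [lp.single_apply, Pi.single_apply, hσ.eq_iff]
  have := lp.inner_single_left (𝕜 := ℂ) (G := fun _ : κ => ℂ) (σ i) 1 (adjoint (lpComp σ hσ) ξ)
  rw [adjoint_inner_right, h, lp.inner_single_left] at this
  simpa using this.symm

theorem adjoint_lpComp_apply_of_notMem (σ : ι → κ) (hσ : Function.Injective σ) (ξ : ℓ²(ι))
    {k : κ} (hk : ∀ i, σ i ≠ k) : adjoint (lpComp σ hσ) ξ k = 0 := by
  classical
  have h : lpComp σ hσ (lp.single 2 k 1) = 0 := by
    ext j
    simp [lp.single_apply, hk]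
  have := lp.inner_single_left (𝕜 := ℂ) (G := fun _ : κ => ℂ) k 1 (adjoint (lpComp σ hσ) ξ)
  rw [adjoint_inner_right, h] at this
  simpa using this.symm

theorem adjoint_lpComp_equiv (e : ι ≃ κ) :
    adjoint (lpComp e e.injective) = lpComp e.symm e.symm.injective := by
  classical
  ext1 ξ
  ext k
  obtain ⟨i, rfl⟩ := e.surjective k
  rw [adjoint_lpComp_apply]
  simp

/-- Infinitely many copies (indexed by `ι`) of the free Jacobi matrix. -/
def jacobi (ι : Type*) : ℓ²(ℕ × ι) →L[ℂ] ℓ²(ℕ × ι) :=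
  lpComp (Prod.map Nat.succ id) (Nat.succ_injective.prodMap Function.injective_id) +
    adjoint (lpComp (Prod.map Nat.succ id) (Nat.succ_injective.prodMap Function.injective_id))

theorem adjoint_jacobi : adjoint (jacobi ι) = jacobi ι := by
  rw [jacobi, map_add, adjoint_adjoint, add_comm]

theorem jacobi_apply_zero (ξ : ℓ²(ℕ × ι)) (i : ι) : jacobi ι ξ (0, i) = ξ (1, i) := by
  have h := adjoint_lpComp_apply_of_notMem (Prod.map Nat.succ (id : ι → ι))
    (Nat.succ_injective.prodMap Function.injective_id) ξ (k := (0, i)) (by simp)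
  simp [jacobi, h]

theorem jacobi_apply_succ (ξ : ℓ²(ℕ × ι)) (n : ℕ) (i : ι) :
    jacobi ι ξ (n + 1, i) = ξ (n + 2, i) + ξ (n, i) := by
  classical
  have h := adjoint_lpComp_apply (Prod.map Nat.succ (id : ι → ι))
    (Nat.succ_injective.prodMap Function.injective_id) ξ (n, i)
  simp only [Prod.map, Nat.succ_eq_add_one, id] at h
  simp [jacobi, h]

theorem jacobi_single_zero [DecidableEq ι] (i : ι) :
    jacobi ι (lp.single 2 (0, i) 1) = lp.single 2 (1, i) 1 := by
  ext ⟨n, j⟩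
  rcases n with _ | n
  · rw [jacobi_apply_zero]; simp [lp.single_apply]
  · rw [jacobi_apply_succ]; simp [lp.single_apply, Pi.single_apply]

theorem jacobi_single_succ [DecidableEq ι] (n : ℕ) (i : ι) :
    jacobi ι (lp.single 2 (n + 1, i) 1) = lp.single 2 (n + 2, i) 1 + lp.single 2 (n, i) 1 := by
  ext ⟨k, j⟩
  rcases k with _ | k
  · rw [jacobi_apply_zero]; simp [lp.single_apply, Pi.single_apply, eq_comm]
  · rw [jacobi_apply_succ, add_comm]; simp [lp.single_apply, Pi.single_apply]

section Wold

variable {H : Type*} [NormedAddCommGroup H] [InnerProductSpace ℂ H] [CompleteSpace H]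

theorem orthonormal_pow_apply {V : H →L[ℂ] H} (hV : ∀ x, adjoint V (V x) = x) {w : ι → H}
    (hw : Orthonormal ℂ w) (hw0 : ∀ i, adjoint V (w i) = 0) :
    Orthonormal ℂ fun p : ℕ × ι => (V ^ p.1) (w p.2) := by
  classical
  have hpow : ∀ (n : ℕ) x y, ⟪(V ^ n) x, (V ^ n) y⟫_ℂ = ⟪x, y⟫_ℂ := fun n => by
    induction n with
    | zero => intro x y; rw [pow_zero]; rfl
    | succ n ih =>
      intro x y
      rw [pow_succ]
      change ⟪(V ^ n) (V x), (V ^ n) (V y)⟫_ℂ = _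
      rw [ih, ← adjoint_inner_right, hV]
  have hlt : ∀ (n k : ℕ) i j, ⟪(V ^ n) (w i), (V ^ (n + (k + 1))) (w j)⟫_ℂ = 0 := fun n k i j => by
    rw [pow_add]
    change ⟪(V ^ n) (w i), (V ^ n) ((V ^ (k + 1)) (w j))⟫_ℂ = _
    rw [hpow, pow_succ']
    change ⟪w i, V ((V ^ k) (w j))⟫_ℂ = _
    rw [← adjoint_inner_left, hw0, inner_zero_left]
  rw [orthonormal_iff_ite]
  rintro ⟨n, i⟩ ⟨n', j⟩
  dsimp only
  rcases lt_trichotomy n n' with h | rfl | h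
  · obtain ⟨k, rfl⟩ := Nat.exists_eq_add_of_lt h
    rw [add_assoc, hlt, if_neg (by simp)]
  · rw [hpow, orthonormal_iff_ite.1 hw]
    simp
  · obtain ⟨k, rfl⟩ := Nat.exists_eq_add_of_lt h
    rw [← inner_conj_symm, add_assoc, hlt, if_neg (by simp), map_zero]

/-- An isometry `V` and an orthonormal family in the kernel of its adjoint yield copies of the free
Jacobi matrix inside `V + V†`. -/
theorem exists_jacobi_intertwiner {V : H →L[ℂ] H} (hV : ∀ x, adjoint V (V x) = x) {w : ι → H}
    (hw : Orthonormal ℂ w) (hw0 : ∀ i, adjoint V (w i) = 0) :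
    ∃ U : ℓ²(ℕ × ι) →ₗᵢ[ℂ] H, (∀ x, U (jacobi ι x) = V (U x) + adjoint V (U x)) ∧
      ∀ n i, (V ^ n) (w i) ∈ Set.range U := by
  classical
  have ho := (orthonormal_pow_apply hV hw hw0).orthogonalFamily
  have hsingle : ∀ n i, ho.linearIsometry (lp.single 2 (n, i) 1) = (V ^ n) (w i) := fun n i => by
    rw [ho.linearIsometry_apply_single]
    simp
  refine ⟨ho.linearIsometry, fun x => ?_, fun n i => ⟨_, hsingle n i⟩⟩
  have key : ho.linearIsometry.toContinuousLinearMap ∘L jacobi ι =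
      (V + adjoint V) ∘L ho.linearIsometry.toContinuousLinearMap := by
    refine lp.ext_continuousLinearMap (by norm_num) ?_
    rintro ⟨n, i⟩
    ext
    simp only [comp_apply, lp.singleContinuousLinearMap_apply, add_apply,
      LinearIsometry.coe_toContinuousLinearMap]
    have hVs : ∀ n, V ((V ^ n) (w i)) = (V ^ (n + 1)) (w i) := fun n => by rw [pow_succ']; rfl
    rcases n with _ | n
    · rw [jacobi_single_zero, hsingle, hsingle, hVs, pow_zero]
      simp [hw0]
    · rw [jacobi_single_succ, map_add, hsingle, hsingle, hsingle, hVs, ← hVs n, hV]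
  exact congrArg (· x) key

end Wold

section Line

variable {m : ℕ}

/-- The translation of `ℤ^d` by a basis vector. -/
def shiftEquiv {d : ℕ} (j : Fin d) : (Fin d → ℤ) ≃ (Fin d → ℤ) where
  toFun u := Function.update u j (u j + 1)
  invFun u := Function.update u j (u j - 1)
  left_inv u := by simp
  right_inv u := by simp

/-- The adjacency operator of the lines of `ℤ^d` in the direction of a basis vector. -/
def lineOp {d : ℕ} (j : Fin d) : ℓ²(Fin d → ℤ) →L[ℂ] ℓ²(Fin d → ℤ) :=
  lpComp (shiftEquiv j).symm (shiftEquiv j).symm.injective +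
    lpComp (shiftEquiv j) (shiftEquiv j).injective

theorem lineOp_apply {d : ℕ} (j : Fin d) (ξ : ℓ²(Fin d → ℤ)) (u : Fin d → ℤ) :
    lineOp j ξ u = ξ (Function.update u j (u j - 1)) + ξ (Function.update u j (u j + 1)) := rfl

theorem adjoint_lineOp {d : ℕ} (j : Fin d) : adjoint (lineOp j) = lineOp j := by
  rw [lineOp, map_add, adjoint_lpComp_equiv, adjoint_lpComp_equiv, Equiv.symm_symm, add_comm]

theorem lineOp_zero_apply_cons (ξ : ℓ²(Fin (m + 1) → ℤ)) (a : ℤ) (k : Fin m → ℤ) :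
    lineOp 0 ξ (Fin.cons a k : Fin (m + 1) → ℤ) =
      ξ (Fin.cons (a - 1) k : Fin (m + 1) → ℤ) + ξ (Fin.cons (a + 1) k : Fin (m + 1) → ℤ) := by
  rw [lineOp_apply, Fin.cons_zero, Fin.update_cons_zero, Fin.update_cons_zero]

theorem cons_add_injective (b : ℤ) {e : ι → Fin m → ℤ} (he : Function.Injective e) :
    Function.Injective fun p : ℕ × ι =>
      (Fin.cons (b + (p.1 + 1)) (e p.2) : Fin (m + 1) → ℤ) := by
  rintro ⟨n, i⟩ ⟨n', i'⟩ h
  obtain ⟨h1, h2⟩ := Fin.cons_injective2 h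
  simp only [add_right_inj, add_left_inj, Nat.cast_inj] at h1
  exact Prod.ext h1 (he h2)

theorem cons_sub_injective (b : ℤ) {e : ι → Fin m → ℤ} (he : Function.Injective e) :
    Function.Injective fun p : ℕ × ι =>
      (Fin.cons (b - (p.1 + 1)) (e p.2) : Fin (m + 1) → ℤ) := by
  rintro ⟨n, i⟩ ⟨n', i'⟩ h
  obtain ⟨h1, h2⟩ := Fin.cons_injective2 h
  simp only [sub_right_inj, add_left_inj, Nat.cast_inj] at h1
  exact Prod.ext h1 (he h2)

/-- Twice the odd part, with respect to the reflection of the first coordinate at `b`. -/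
def oddPart (b : ℤ) {e : ι → Fin m → ℤ} (he : Function.Injective e) :
    ℓ²(Fin (m + 1) → ℤ) →L[ℂ] ℓ²(ℕ × ι) :=
  lpComp _ (cons_add_injective b he) - lpComp _ (cons_sub_injective b he)

theorem oddPart_apply (b : ℤ) {e : ι → Fin m → ℤ} (he : Function.Injective e)
    (ξ : ℓ²(Fin (m + 1) → ℤ)) (n : ℕ) (i : ι) :
    oddPart b he ξ (n, i) = ξ (Fin.cons (b + (n + 1)) (e i) : Fin (m + 1) → ℤ) -
      ξ (Fin.cons (b - (n + 1)) (e i) : Fin (m + 1) → ℤ) := rfl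

theorem oddPart_comp_lineOp (b : ℤ) {e : ι → Fin m → ℤ} (he : Function.Injective e) :
    oddPart b he ∘L lineOp 0 = jacobi ι ∘L oddPart b he := by
  ext1 ξ
  ext ⟨n, i⟩
  rw [comp_apply, comp_apply, oddPart_apply, lineOp_zero_apply_cons, lineOp_zero_apply_cons]
  rcases n with _ | n
  · rw [jacobi_apply_zero, oddPart_apply]
    push_cast
    ring_nf
  · rw [jacobi_apply_succ, oddPart_apply, oddPart_apply]
    push_cast
    ring_nf

theorem norm_adjoint_oddPart_zero {e : ι → Fin m → ℤ} (he : Function.Injective e)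
    (x : ℓ²(ℕ × ι)) : ‖adjoint (oddPart 0 he) x‖ = √2 * ‖x‖ := by
  classical
  have h : oddPart 0 he (adjoint (oddPart 0 he) x) = (2 : ℂ) • x := by
    ext ⟨n, i⟩
    have h1 := adjoint_lpComp_apply _ (cons_add_injective 0 he) x (n, i)
    have h2 := adjoint_lpComp_apply _ (cons_sub_injective 0 he) x (n, i)
    have h3 := adjoint_lpComp_apply_of_notMem _ (cons_add_injective 0 he) x
      (k := Fin.cons (0 - ((n : ℤ) + 1)) (e i)) (fun p hp => by
        have := (Fin.cons_injective2 hp).1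
        omega)
    have h4 := adjoint_lpComp_apply_of_notMem _ (cons_sub_injective 0 he) x
      (k := Fin.cons (0 + ((n : ℤ) + 1)) (e i)) (fun p hp => by
        have := (Fin.cons_injective2 hp).1
        omega)
    dsimp only at h1 h2
    rw [oddPart_apply, oddPart, map_sub, sub_apply]
    simp only [lp.coeFn_sub, Pi.sub_apply, lp.coeFn_smul, Pi.smul_apply, smul_eq_mul]
    rw [h1, h2, h3, h4]
    ring
  have h5 : ‖adjoint (oddPart 0 he) x‖ ^ 2 = 2 * ‖x‖ ^ 2 := by
    have h6 : ⟪adjoint (oddPart 0 he) x, adjoint (oddPart 0 he) x⟫_ℂ = 2 * ⟪x, x⟫_ℂ := by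
      rw [adjoint_inner_left, h, inner_smul_right]
    rw [inner_self_eq_norm_sq_to_K, inner_self_eq_norm_sq_to_K] at h6
    apply Complex.ofReal_injective
    push_cast
    exact h6
  rw [← sq_eq_sq₀ (norm_nonneg _) (by positivity), h5, mul_pow, Real.sq_sqrt (by norm_num)]

/-- Countably many copies of the free Jacobi matrix embed into countably many copies of
the adjacency operator of the line. -/
theorem jacobi_embeds_lineOp {e : ι → Fin m → ℤ} (he : Function.Injective e) (c : ℂ) :
    Embeds (fun x y => (c • jacobi ι) x = y)
      (fun x y => (c • lineOp (0 : Fin (m + 1))) x = y) := by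
  have hcomm : lineOp 0 ∘L adjoint (oddPart 0 he) = adjoint (oddPart 0 he) ∘L jacobi ι := by
    have := congrArg adjoint (oddPart_comp_lineOp 0 he)
    rwa [adjoint_comp, adjoint_comp, adjoint_lineOp, adjoint_jacobi] at this
  refine ⟨⟨((((√2)⁻¹ : ℝ) : ℂ) • adjoint (oddPart 0 he)).toLinearMap, fun x => ?_⟩, ?_⟩
  · change ‖(((√2)⁻¹ : ℝ) : ℂ) • adjoint (oddPart 0 he) x‖ = ‖x‖
    rw [norm_smul, norm_adjoint_oddPart_zero, Complex.norm_real, Real.norm_eq_abs,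
      abs_of_nonneg (by positivity), inv_mul_cancel_left₀ (by positivity)]
  · rintro x _ rfl
    change c • lineOp 0 ((((√2)⁻¹ : ℝ) : ℂ) • adjoint (oddPart 0 he) x) =
      (((√2)⁻¹ : ℝ) : ℂ) • adjoint (oddPart 0 he) (c • jacobi ι x)
    have h1 : lineOp 0 (adjoint (oddPart 0 he) x) = adjoint (oddPart 0 he) (jacobi ι x) :=
      congrArg (· x) hcomm
    rw [map_smul, map_smul, h1, smul_comm]

theorem eq_zero_of_oddPart_eq_zero {ξ : ℓ²(Fin (m + 1) → ℤ)}
    (h0 : oddPart 0 (Function.injective_id (α := Fin m → ℤ)) ξ = 0)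
    (h1 : oddPart 1 (Function.injective_id (α := Fin m → ℤ)) ξ = 0) : ξ = 0 := by
  have hf : ∀ (b : ℤ), oddPart b (Function.injective_id (α := Fin m → ℤ)) ξ = 0 →
      ∀ k z, ξ (Fin.cons (b + z) k : Fin (m + 1) → ℤ) =
        ξ (Fin.cons (b - z) k : Fin (m + 1) → ℤ) := by
    intro b hb k
    have hpos : ∀ n : ℕ, ξ (Fin.cons (b + (n + 1)) k : Fin (m + 1) → ℤ) =
        ξ (Fin.cons (b - (n + 1)) k : Fin (m + 1) → ℤ) := fun n => by
      have := congrArg (fun η : ℓ²(ℕ × (Fin m → ℤ)) => η (n, k)) hb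
      simp only [oddPart_apply] at this
      exact sub_eq_zero.1 this
    intro z
    rcases lt_trichotomy z 0 with hz | rfl | hz
    · obtain ⟨n, hn⟩ := Int.eq_succ_of_zero_lt (neg_pos.2 hz)
      obtain rfl : z = -((n : ℤ) + 1) := by omega
      rw [sub_neg_eq_add, hpos n, sub_eq_add_neg]
    · simp
    · obtain ⟨n, rfl⟩ := Int.eq_succ_of_zero_lt hz
      exact_mod_cast hpos n
  have hper : ∀ k z, ξ (Fin.cons (z + 2) k : Fin (m + 1) → ℤ) =
      ξ (Fin.cons z k : Fin (m + 1) → ℤ) := fun k z => by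
    have e1 := hf 1 h1 k (z + 1)
    have e0 := hf 0 h0 k z
    rw [show (1 : ℤ) + (z + 1) = z + 2 by ring, show (1 : ℤ) - (z + 1) = -z by ring] at e1
    rw [zero_add, zero_sub] at e0
    rw [e1, ← e0]
  ext u
  obtain ⟨a, k, rfl⟩ : ∃ a k, u = Fin.cons a k := ⟨u 0, Fin.tail u, (Fin.cons_self_tail u).symm⟩
  have hn : ∀ n : ℕ, ξ (Fin.cons (a + 2 * n) k : Fin (m + 1) → ℤ) =
      ξ (Fin.cons a k : Fin (m + 1) → ℤ) := fun n => by
    induction n with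
    | zero => simp
    | succ n ih =>
      rw [← ih, ← hper k (a + 2 * n)]
      push_cast
      ring_nf
  have hinj : Function.Injective fun n : ℕ => (Fin.cons (a + 2 * n) k : Fin (m + 1) → ℤ) :=
    fun n n' h => by
      have := (Fin.cons_injective2 h).1
      omega
  have hs := ((memℓp_gen_iff (by norm_num)).1 (lp.memℓp ξ)).comp_injective hinj
  simp only [Function.comp_def, hn, summable_const_iff] at hs
  simpa using hs

/-- Countably many copies of the adjacency operator of the line embed into countably many copies of
the free Jacobi matrix. -/
theorem exists_injective_lineOp_jacobi (m : ℕ) :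
    ∃ T : ℓ²(Fin (m + 1) → ℤ) →L[ℂ] ℓ²(ℕ × (Bool × (Fin m → ℤ))),
      Function.Injective T ∧ T ∘L lineOp 0 = jacobi (Bool × (Fin m → ℤ)) ∘L T := by
  classical
  have hinj : ∀ b : Bool, Function.Injective fun p : ℕ × (Fin m → ℤ) => (p.1, (b, p.2)) := by
    rintro b ⟨n, k⟩ ⟨n', k'⟩ h
    simpa using h
  let E : Bool → ℓ²(ℕ × (Bool × (Fin m → ℤ))) →L[ℂ] ℓ²(ℕ × (Fin m → ℤ)) :=
    fun b => lpComp _ (hinj b)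
  have hE : ∀ b, jacobi _ ∘L adjoint (E b) = adjoint (E b) ∘L jacobi _ := fun b => by
    have : E b ∘L jacobi _ = jacobi _ ∘L E b := by
      ext1 ξ
      ext ⟨n, k⟩
      change jacobi _ ξ (n, (b, k)) = jacobi _ (E b ξ) (n, k)
      rcases n with _ | n
      · rw [jacobi_apply_zero, jacobi_apply_zero]; rfl
      · rw [jacobi_apply_succ, jacobi_apply_succ]; rfl
    have := congrArg adjoint this
    rwa [adjoint_comp, adjoint_comp, adjoint_jacobi, adjoint_jacobi] at this
  let D : ℤ → ℓ²(Fin (m + 1) → ℤ) →L[ℂ] ℓ²(ℕ × (Fin m → ℤ)) := fun b =>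
    oddPart b (Function.injective_id (α := Fin m → ℤ))
  have hD : ∀ b, D b ∘L lineOp 0 = jacobi _ ∘L D b := fun b => oddPart_comp_lineOp b _
  refine ⟨adjoint (E false) ∘L D 0 + adjoint (E true) ∘L D 1, ?_, ?_⟩
  · rw [injective_iff_map_eq_zero]
    intro ξ hξ
    have hcoord : ∀ p, adjoint (E false) (D 0 ξ) p + adjoint (E true) (D 1 ξ) p = 0 := fun p =>
      congrArg (fun η : ℓ²(ℕ × (Bool × (Fin m → ℤ))) => η p) hξ
    refine eq_zero_of_oddPart_eq_zero ?_ ?_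
    · ext ⟨n, k⟩
      have h1 := hcoord (n, (false, k))
      rw [adjoint_lpComp_apply_of_notMem _ (hinj true) _ (by simp), add_zero,
        adjoint_lpComp_apply _ (hinj false) _ (n, k)] at h1
      exact h1
    · ext ⟨n, k⟩
      have h1 := hcoord (n, (true, k))
      rw [adjoint_lpComp_apply_of_notMem _ (hinj false) _ (by simp), zero_add,
        adjoint_lpComp_apply _ (hinj true) _ (n, k)] at h1
      exact h1
  · rw [add_comp, comp_add, comp_assoc, comp_assoc, hD, hD, ← comp_assoc, ← comp_assoc, ← hE, ← hE]
    rfl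

end Line

section PureIsometry

universe u

variable {H : Type u} [NormedAddCommGroup H] [InnerProductSpace ℂ H] [CompleteSpace H]

/-- The Wold decomposition of a pure isometry. -/
theorem exists_wold {V : H →L[ℂ] H} (hV : ∀ x, adjoint V (V x) = x)
    (hpure : ∀ x, (∀ n : ℕ, ∃ y, x = (V ^ n) y) → x = 0) :
    ∃ (s : Type u) (w : s → H) (_ : Orthonormal ℂ w)
      (U : ℓ²(ℕ × s) ≃ₗᵢ[ℂ] H), ∀ x, U (jacobi s x) = V (U x) + adjoint V (U x) := by
  set K : Submodule ℂ H := (adjoint V).toLinearMap.ker with hK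
  have hKc : IsClosed (K : Set H) := (adjoint V).isClosed_ker
  have : CompleteSpace K := hKc.completeSpace_coe
  obtain ⟨s, b, -⟩ := exists_hilbertBasis ℂ K
  let w : s → H := fun i => b i
  have hw : Orthonormal ℂ w := b.orthonormal.comp_linearIsometry K.subtypeₗᵢ
  have hw0 : ∀ i, adjoint V (w i) = 0 := fun i => (b i).2
  obtain ⟨U, hU, hUr⟩ := exists_jacobi_intertwiner hV hw hw0
  have hsurj : Function.Surjective U := by
    have hcl : IsClosed ((LinearMap.range U.toLinearMap : Submodule ℂ H) : Set H) := by
      have := U.isometry.isClosedEmbedding.isClosed_range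
      convert this
      ext; simp
    have := hcl.completeSpace_coe
    rw [← LinearIsometry.coe_toLinearMap, ← LinearMap.range_eq_top,
      ← Submodule.orthogonal_eq_bot_iff, Submodule.eq_bot_iff]
    intro x hx
    rw [Submodule.mem_orthogonal'] at hx
    have hx' : ∀ n i, ⟪x, (V ^ n) (w i)⟫_ℂ = 0 := fun n i => hx _ (hUr n i)
    have hproj : ∀ y, (∀ i, ⟪y, w i⟫_ℂ = 0) → V (adjoint V y) = y := fun y hy => by
      have hmem : y - V (adjoint V y) ∈ K := by
        change adjoint V (y - V (adjoint V y)) = 0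
        rw [map_sub, hV, sub_self]
      have : (⟨_, hmem⟩ : K) = 0 := by
        refine b.repr.injective ?_
        ext i
        rw [b.repr_apply_apply, map_zero]
        change ⟪w i, y - V (adjoint V y)⟫_ℂ = 0
        rw [inner_sub_right, ← adjoint_inner_left, hw0, inner_zero_left, sub_zero,
          ← inner_conj_symm, hy, map_zero]
      exact (sub_eq_zero.1 (congrArg Subtype.val this)).symm
    have hn : ∀ n : ℕ, ∃ y, x = (V ^ n) y ∧ ∀ k i, ⟪y, (V ^ k) (w i)⟫_ℂ = 0 := fun n => by
      induction n with
      | zero => exact ⟨x, by rw [pow_zero]; rfl, hx'⟩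
      | succ n ih =>
        obtain ⟨y, hy, hyk⟩ := ih
        refine ⟨adjoint V y, ?_, fun k i => ?_⟩
        · rw [pow_succ]
          change x = (V ^ n) (V (adjoint V y))
          rw [hproj y fun i => hyk 0 i, hy]
        · rw [adjoint_inner_left]
          have := hyk (k + 1) i
          rwa [pow_succ'] at this
    exact hpure x fun n => (hn n).imp fun _ h => h.1
  exact ⟨s, w, hw, LinearIsometryEquiv.ofSurjective U hsurj, hU⟩

theorem Orthonormal.countable_index [Countable κ] {w : ι → ℓ²(κ)} (hw : Orthonormal ℂ w) :
    Countable ι := by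
  classical
  have h1 : ∀ v : κ, {i | w i v ≠ 0}.Countable := fun v => by
    have := (hw.inner_products_summable (lp.single 2 v 1)).countable_support
    refine this.mono fun i hi => ?_
    rw [Function.mem_support, ← norm_inner_symm, lp.inner_single_left]
    simpa using hi
  rw [← Set.countable_univ_iff]
  refine (Set.countable_iUnion h1).mono fun i _ => ?_
  rw [Set.mem_iUnion]
  by_contra! h
  refine hw.ne_zero i ?_
  ext v
  simpa using h v

end PureIsometry

section Tree

variable {α : Type*} [Fintype α]

/-- Summation over the children of a vertex of the rooted tree. -/
def childSum (α : Type*) [Fintype α] : ℓ²(List α) →L[ℂ] ℓ²(List α) :=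
  ∑ a : α, lpComp (List.cons a) List.cons_injective

theorem childSum_apply (ξ : ℓ²(List α)) (v : List α) :
    childSum α ξ v = ∑ a, ξ (a :: v) := by
  have h : ∀ s : Finset α,
      (∑ a ∈ s, lpComp (List.cons a) List.cons_injective) ξ v = ∑ a ∈ s, ξ (a :: v) := fun s => by
    rw [sum_apply, lp.coeFn_sum, Finset.sum_apply]
    rfl
  exact h _

theorem adjoint_childSum_apply_nil (ξ : ℓ²(List α)) : adjoint (childSum α) ξ [] = 0 := by
  rw [childSum, map_sum, sum_apply, lp.coeFn_sum, Finset.sum_apply]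
  exact Finset.sum_eq_zero fun a _ => adjoint_lpComp_apply_of_notMem _ _ _ (by simp)

theorem adjoint_childSum_apply_cons (ξ : ℓ²(List α)) (a : α) (v : List α) :
    adjoint (childSum α) ξ (a :: v) = ξ v := by
  classical
  rw [childSum, map_sum, sum_apply, lp.coeFn_sum, Finset.sum_apply, Finset.sum_eq_single a]
  · exact adjoint_lpComp_apply _ _ _ _
  · intro b _ hb
    exact adjoint_lpComp_apply_of_notMem _ _ _ (by simp [hb])
  · simp

theorem childSum_adjoint_childSum (ξ : ℓ²(List α)) :
    childSum α (adjoint (childSum α) ξ) = (Fintype.card α : ℂ) • ξ := by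
  ext v
  simp [childSum_apply, adjoint_childSum_apply_cons]

theorem childSum_single_cons [DecidableEq α] (a : α) (v : List α) :
    childSum α (lp.single 2 (a :: v) 1) = lp.single 2 v 1 := by
  ext u
  rw [childSum_apply]
  by_cases h : u = v
  · simp [lp.single_apply, Pi.single_apply, h]
  · simp [lp.single_apply, h]

theorem adjoint_tree : adjoint (childSum α + adjoint (childSum α)) =
    childSum α + adjoint (childSum α) := by
  rw [map_add, adjoint_adjoint, add_comm]

section

variable (d : ℕ)

/-- The isometry shifting functions on the tree away from the root. -/
def rootShift (α : Type*) [Fintype α] : ℓ²(List α) →L[ℂ] ℓ²(List α) :=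
  (d : ℂ)⁻¹ • adjoint (childSum α)

variable {d}

theorem adjoint_rootShift : adjoint (rootShift d α) = (d : ℂ)⁻¹ • childSum α := by
  rw [rootShift, LinearIsometryEquiv.map_smulₛₗ, adjoint_adjoint]
  simp

theorem adjoint_rootShift_rootShift (hd : 0 < d) (hα : Fintype.card α = d ^ 2) (ξ : ℓ²(List α)) :
    adjoint (rootShift d α) (rootShift d α ξ) = ξ := by
  have hd' : (d : ℂ) ≠ 0 := by exact_mod_cast hd.ne'
  rw [adjoint_rootShift, rootShift, smul_apply, smul_apply, map_smul, childSum_adjoint_childSum, hα,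
    smul_smul, smul_smul]
  push_cast
  rw [show (d : ℂ)⁻¹ * (d : ℂ)⁻¹ * (d : ℂ) ^ 2 = 1 by field_simp, one_smul]

theorem tree_apply (hd : 0 < d) (ξ : ℓ²(List α)) : (childSum α + adjoint (childSum α)) ξ =
    (d : ℂ) • (rootShift d α ξ + adjoint (rootShift d α) ξ) := by
  have hd' : (d : ℂ) ≠ 0 := by exact_mod_cast hd.ne'
  rw [adjoint_rootShift, rootShift, smul_apply, smul_apply, ← smul_add, smul_smul,
    mul_inv_cancel₀ hd', one_smul, add_comm (adjoint _ ξ), add_apply]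

/-- Countably many copies of the free Jacobi matrix embed into the tree. -/
theorem exists_orthonormal_ker [Countable ι] {a b : α} (hab : a ≠ b) :
    ∃ w : ι → ℓ²(List α), Orthonormal ℂ w ∧ ∀ i, childSum α (w i) = 0 := by
  classical
  obtain ⟨e, he⟩ := exists_injective_nat ι
  let l : ι → List α := fun i => List.replicate (e i) a
  have hl : ∀ i j, l i = l j ↔ i = j := fun i j =>
    ⟨fun h => he (by simpa [l] using congrArg List.length h), fun h => h ▸ rfl⟩
  refine ⟨fun i => (((√2)⁻¹ : ℝ) : ℂ) • (lp.single 2 (a :: l i) 1 - lp.single 2 (b :: l i) 1),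
    ?_, fun i => ?_⟩
  · rw [orthonormal_iff_ite]
    intro i j
    have h2 : (((√2)⁻¹ : ℝ) : ℂ) * ((((√2)⁻¹ : ℝ) : ℂ) * 2) = 1 := by
      norm_cast
      rw [← mul_assoc, ← mul_inv, Real.mul_self_sqrt (by norm_num)]
      norm_num
    rw [inner_smul_left, inner_smul_right, Complex.conj_ofReal, inner_sub_left,
      lp.inner_single_left, lp.inner_single_left]
    by_cases h : i = j
    · simp only [h, lp.coeFn_sub, Pi.sub_apply, lp.single_apply]
      have h3 : (1 : ℂ) + 1 = 2 := by norm_num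
      simpa [hab, hab.symm, h3] using h2
    · simp [lp.single_apply, hl, h, hab, hab.symm]
  · rw [map_smul, map_sub, childSum_single_cons, childSum_single_cons, sub_self, smul_zero]

theorem lineOp_embeds_tree (m : ℕ) (hd : 2 ≤ d) (hα : Fintype.card α = d ^ 2) :
    Embeds (fun x y => ((d : ℂ) • lineOp (0 : Fin (m + 1))) x = y)
      (fun x y => (childSum α + adjoint (childSum α)) x = y) := by
  obtain ⟨a, b, hab⟩ := Fintype.one_lt_card_iff.1
    (show 1 < Fintype.card α by rw [hα]; nlinarith)
  obtain ⟨w, hw, hw0⟩ := exists_orthonormal_ker (ι := Bool × (Fin m → ℤ)) hab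
  obtain ⟨U, hU, -⟩ := exists_jacobi_intertwiner
    (adjoint_rootShift_rootShift (by omega) hα) hw
    (fun i => by rw [adjoint_rootShift, smul_apply, hw0, smul_zero])
  obtain ⟨T, hT, hTX⟩ := exists_injective_lineOp_jacobi m
  have h1 : Embeds (fun x y => (lineOp (0 : Fin (m + 1))) x = y)
      (fun x y => jacobi (Bool × (Fin m → ℤ)) x = y) :=
    embeds_of_injective (adjoint_lineOp 0) adjoint_jacobi hT hTX
  refine Embeds.trans (S := fun x y => ((d : ℂ) • jacobi (Bool × (Fin m → ℤ))) x = y) ?_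
    ⟨U, ?_⟩
  · obtain ⟨W, hW⟩ := h1
    refine ⟨W, ?_⟩
    rintro x _ rfl
    rw [smul_apply, smul_apply, hW x _ rfl, map_smul]
  · rintro x _ rfl
    rw [tree_apply (d := d) (by omega), smul_apply, map_smul, hU]

theorem eq_zero_of_forall_eq_rootShift_pow {ξ : ℓ²(List α)}
    (hξ : ∀ n : ℕ, ∃ η, ξ = (rootShift d α ^ n) η) : ξ = 0 := by
  have hzero : ∀ (n : ℕ) (y : ℓ²(List α)) (v : List α), v.length < n →
      (rootShift d α ^ n) y v = 0 := by
    intro n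
    induction n with
    | zero => intro y v h; omega
    | succ n ih =>
      intro y v h
      rw [pow_succ']
      change (d : ℂ)⁻¹ * adjoint (childSum α) ((rootShift d α ^ n) y) v = 0
      rcases v with _ | ⟨a, v⟩
      · rw [adjoint_childSum_apply_nil, mul_zero]
      · rw [adjoint_childSum_apply_cons, ih y v (by simpa using h), mul_zero]
  ext v
  obtain ⟨y, rfl⟩ := hξ (v.length + 1)
  rw [hzero _ _ _ (Nat.lt_succ_self _)]
  rfl

/-- The tree is a countable union of copies of the free Jacobi matrix. -/
theorem tree_embeds_lineOp (m : ℕ) (hd : 0 < d) (hα : Fintype.card α = d ^ 2) :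
    Embeds (fun x y => (childSum α + adjoint (childSum α)) x = y)
      (fun x y => ((d : ℂ) • lineOp (0 : Fin (m + 2))) x = y) := by
  obtain ⟨s, w, hw, U, hU⟩ := exists_wold (adjoint_rootShift_rootShift hd hα)
    fun x => eq_zero_of_forall_eq_rootShift_pow
  have : Countable α := Finite.to_countable
  have hcount : Countable s := hw.countable_index
  obtain ⟨e, he⟩ := exists_injective_nat s
  have he' : Function.Injective fun i : s => (fun _ : Fin (m + 1) => (e i : ℤ)) := fun i j h =>
    he (Nat.cast_injective (R := ℤ) (congrFun h 0))
  have h1 : Embeds (fun x y => (childSum α + adjoint (childSum α)) x = y)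
      (fun x y => ((d : ℂ) • jacobi s) x = y) := by
    refine ⟨U.symm.toLinearIsometry, ?_⟩
    rintro x _ rfl
    obtain ⟨z, rfl⟩ := U.surjective x
    have h2 : (childSum α + adjoint (childSum α)) (U z) = U (((d : ℂ) • jacobi s) z) := by
      rw [tree_apply (d := d) hd, ← hU, ← map_smul, smul_apply]
    rw [h2]
    exact (congrArg _ (U.symm_apply_apply z)).trans (U.symm_apply_apply _).symm
  exact h1.trans (jacobi_embeds_lineOp he' d)

end

end Tree

end Sequence

section Multiplication

variable {X Y : Type*} [MeasurableSpace X] [MeasurableSpace Y]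

/-- The graph of the operator of multiplication by `f`. -/
def MulRel (f : X → ℝ) (μ : Measure X) (h h' : Lp ℂ 2 μ) : Prop :=
  h' =ᵐ[μ] fun x => (f x : ℂ) * h x

theorem mulRel_embeds_of_absolutelyContinuous {μ ν : Measure X} [IsFiniteMeasure μ]
    [IsFiniteMeasure ν] (hac : μ ≪ ν) (f : X → ℝ) : Embeds (MulRel f μ) (MulRel f ν) := by
  set r : X → ℝ := fun x => √((μ.rnDeriv ν x).toReal) with hr
  have hrm : Measurable r := (Measure.measurable_rnDeriv μ ν).ennreal_toReal.sqrt
  have hr2 : ∀ᵐ x ∂ν, ‖(r x : ℂ)‖ₑ ^ (2 : ℝ) = μ.rnDeriv ν x := by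
    filter_upwards [Measure.rnDeriv_lt_top μ ν] with x hx
    rw [← ofReal_norm, Complex.norm_real, Real.norm_eq_abs,
      abs_of_nonneg (Real.sqrt_nonneg _), ENNReal.ofReal_rpow_of_nonneg (Real.sqrt_nonneg _)
      (by norm_num), Real.rpow_two, Real.sq_sqrt ENNReal.toReal_nonneg, ENNReal.ofReal_toReal hx.ne]
  have hae : ∀ {p : X → Prop}, (∀ᵐ x ∂μ, p x) → ∀ᵐ x ∂ν, r x ≠ 0 → p x := fun {p} hp => by
    rw [← Measure.withDensity_rnDeriv_eq μ ν hac,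
      ae_withDensity_iff (Measure.measurable_rnDeriv μ ν)] at hp
    filter_upwards [hp] with x hx hx'
    refine hx fun h0 => hx' ?_
    rw [hr]
    simp [h0]
  have hnorm : ∀ h : Lp ℂ 2 μ, eLpNorm (fun x => (r x : ℂ) * h x) 2 ν = eLpNorm h 2 μ := fun h => by
    rw [eLpNorm_eq_lintegral_rpow_enorm_toReal (by norm_num) (by norm_num),
      eLpNorm_eq_lintegral_rpow_enorm_toReal (by norm_num) (by norm_num)]
    congr 1
    rw [← lintegral_rnDeriv_mul hac
      ((Lp.stronglyMeasurable h).enorm.pow_const _).aemeasurable]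
    refine lintegral_congr_ae ?_
    filter_upwards [hr2] with x hx
    rw [enorm_mul, ENNReal.toReal_ofNat, ENNReal.mul_rpow_of_nonneg _ _ (by norm_num), hx]
  have hmem : ∀ h : Lp ℂ 2 μ, MemLp (fun x => (r x : ℂ) * h x) 2 ν := fun h =>
    ⟨((Complex.measurable_ofReal.comp hrm).mul
      (Lp.stronglyMeasurable h).measurable).aestronglyMeasurable, by
      rw [hnorm]; exact Lp.eLpNorm_lt_top h⟩
  have hmul : ∀ {h h' : X → ℂ}, h =ᵐ[μ] h' →
      (fun x => (r x : ℂ) * h x) =ᵐ[ν] fun x => (r x : ℂ) * h' x := fun {h h'} hh => by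
    filter_upwards [hae hh] with x hx
    by_cases h0 : r x = 0
    · simp [h0]
    · rw [hx h0]
  let U : Lp ℂ 2 μ →ₗᵢ[ℂ] Lp ℂ 2 ν :=
    { toFun := fun h => (hmem h).toLp _
      map_add' := fun h h' => by
        ext1
        refine (hmem _).coeFn_toLp.trans ((hmul (Lp.coeFn_add h h')).trans ?_)
        filter_upwards [Lp.coeFn_add ((hmem h).toLp _) ((hmem h').toLp _), (hmem h).coeFn_toLp,
          (hmem h').coeFn_toLp] with x h1 h2 h3
        rw [h1, Pi.add_apply, Pi.add_apply, h2, h3, mul_add]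
      map_smul' := fun c h => by
        ext1
        refine (hmem _).coeFn_toLp.trans ((hmul (Lp.coeFn_smul c h)).trans ?_)
        filter_upwards [Lp.coeFn_smul c ((hmem h).toLp _), (hmem h).coeFn_toLp] with x h1 h2
        rw [RingHom.id_apply, h1, Pi.smul_apply, Pi.smul_apply, h2, smul_eq_mul, smul_eq_mul,
          mul_left_comm]
      norm_map' := fun h => by
        change ‖(hmem h).toLp _‖ = _
        rw [Lp.norm_toLp, hnorm, Lp.norm_def] }
  refine ⟨U, fun h h' hh => ?_⟩
  refine (hmem h').coeFn_toLp.trans ((hmul hh).trans ?_)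
  filter_upwards [(hmem h).coeFn_toLp] with x hx
  rw [show U h x = _ from hx, mul_left_comm]

theorem mulRel_embeds_of_measurePreserving {μ : Measure X} {ν : Measure Y} {φ : Y → X}
    (hφ : MeasurePreserving φ ν μ) {F : X → ℝ} {G : Y → ℝ} (hFG : F ∘ φ =ᵐ[ν] G) :
    Embeds (MulRel F μ) (MulRel G ν) := by
  refine ⟨Lp.compMeasurePreservingₗᵢ ℂ φ hφ, fun h h' hh => ?_⟩
  have h1 := Lp.coeFn_compMeasurePreserving h hφ
  have h2 := Lp.coeFn_compMeasurePreserving h' hφ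
  have h3 := hφ.quasiMeasurePreserving.ae_eq_comp hh
  filter_upwards [h1, h2, h3, hFG] with y h1 h2 h3 h4
  refine h2.trans (h3.trans ?_)
  change (F (φ y) : ℂ) * h (φ y) = (G y : ℂ) * (Lp.compMeasurePreserving φ hφ h) y
  rw [h1, ← h4]
  rfl

/-- A map transforming `F` into `G` whose image charges `μ` embeds multiplication by `F` into
multiplication by `G`. -/
theorem mulRel_embeds_of_map {μ : Measure X} {ν ν' : Measure Y} [IsFiniteMeasure μ]
    [IsFiniteMeasure ν] [IsFiniteMeasure ν'] {φ : Y → X} (hφ : Measurable φ) (hν : ν' ≪ ν)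
    (hμ : μ ≪ ν'.map φ) {F : X → ℝ} {G : Y → ℝ} (hFG : F ∘ φ =ᵐ[ν'] G) :
    Embeds (MulRel F μ) (MulRel G ν) :=
  (mulRel_embeds_of_absolutelyContinuous hμ F).trans
    ((mulRel_embeds_of_measurePreserving ⟨hφ, rfl⟩ hFG).trans
      (mulRel_embeds_of_absolutelyContinuous hν G))

end Multiplication

section Differentiable

variable {E : Type*} [NormedAddCommGroup E] [NormedSpace ℝ E] [FiniteDimensional ℝ E]
  [MeasurableSpace E] [BorelSpace E]

theorem restrict_absolutelyContinuous_map (μ : Measure E) [μ.IsAddHaarMeasure] {φ : E → E}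
    (hφ : Measurable φ) {s t : Set E} (hd : DifferentiableOn ℝ φ t)
    (hs : ∀ᵐ x ∂μ.restrict s, x ∈ φ '' t) : μ.restrict s ≪ (μ.restrict t).map φ := by
  refine Measure.AbsolutelyContinuous.mk fun N hN hN0 => ?_
  rw [Measure.map_apply hφ hN, Measure.restrict_apply (hφ hN)] at hN0
  have h1 : μ (φ '' (φ ⁻¹' N ∩ t)) = 0 :=
    addHaar_image_eq_zero_of_differentiableOn_of_addHaar_eq_zero μ
      (hd.mono inter_subset_right) hN0
  refine measure_mono_null_ae ?_ (Measure.restrict_le_self.absolutelyContinuous h1)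
  filter_upwards [hs] with x hx hxN
  obtain ⟨y, hy, rfl⟩ := hx
  exact ⟨y, ⟨hxN, hy⟩, rfl⟩

/-- A differentiable map transforming `F` into `G` and covering almost all of `s` embeds
multiplication by `F` on `s` into multiplication by `G` on `u`. -/
theorem mulRel_embeds_of_differentiableOn (μ : Measure E) [μ.IsAddHaarMeasure] {φ : E → E}
    (hφ : Measurable φ) {s t u : Set E} (hsf : μ s ≠ ∞) (huf : μ u ≠ ∞) (ht : MeasurableSet t)
    (htu : t ⊆ u) (hd : DifferentiableOn ℝ φ t) (hs : ∀ᵐ x ∂μ.restrict s, x ∈ φ '' t)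
    {F G : E → ℝ} (hFG : ∀ x ∈ t, F (φ x) = G x) :
    Embeds (MulRel F (μ.restrict s)) (MulRel G (μ.restrict u)) := by
  have h1 : IsFiniteMeasure (μ.restrict s) := isFiniteMeasure_restrict.2 hsf
  have h2 : IsFiniteMeasure (μ.restrict u) := isFiniteMeasure_restrict.2 huf
  have h3 : IsFiniteMeasure (μ.restrict t) :=
    isFiniteMeasure_restrict.2 (measure_ne_top_of_subset htu huf)
  exact mulRel_embeds_of_map hφ (Measure.restrict_mono_set μ htu).absolutelyContinuous
    (restrict_absolutelyContinuous_map μ hφ hd hs)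
    ((ae_restrict_iff' ht).2 (Eventually.of_forall hFG))

end Differentiable

section Symbols

open Real

/-- The number in `[-1/2, 1/2]` with the same sign as `x` at which `cos (2 * π * x)` takes the
value `t`. -/
def signedArccos (x t : ℝ) : ℝ := x / |x| * (arccos t / (2 * π))

theorem cos_signedArccos {x t : ℝ} (hx : x ≠ 0) (ht : |t| ≤ 1) :
    cos (2 * π * signedArccos x t) = t := by
  have h : cos (arccos t) = t := cos_arccos (abs_le.1 ht).1 (abs_le.1 ht).2
  rw [signedArccos]
  rcases hx.lt_or_gt with hx | hx
  · rw [abs_of_neg hx, div_neg, div_self hx.ne, show 2 * π * (-1 * (arccos t / (2 * π))) =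
      -arccos t by field_simp, cos_neg, h]
  · rw [abs_of_pos hx, div_self hx.ne', show 2 * π * (1 * (arccos t / (2 * π))) =
      arccos t by field_simp, h]

theorem signedArccos_cos {x : ℝ} (hx : x ≠ 0) (hx' : |x| < 1 / 2) :
    signedArccos x (cos (2 * π * x)) = x := by
  have h : arccos (cos (2 * π * x)) = 2 * π * |x| := by
    rw [← cos_abs, abs_mul, abs_of_pos two_pi_pos]
    exact arccos_cos (by positivity) (by nlinarith [pi_pos])
  have hx0 : |x| ≠ 0 := abs_ne_zero.2 hx
  rw [signedArccos, h]
  field_simp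

theorem abs_cos_lt_one {x : ℝ} (hx : x ≠ 0) (hx' : |x| < 1 / 2) : |cos (2 * π * x)| < 1 := by
  rw [← cos_abs, abs_mul, abs_of_pos two_pi_pos, abs_lt]
  have h0 : 0 < |x| := abs_pos.2 hx
  constructor
  · rw [← cos_pi]
    exact cos_lt_cos_of_nonneg_of_le_pi (by positivity) le_rfl (by nlinarith [pi_pos])
  · rw [← cos_zero]
    exact cos_lt_cos_of_nonneg_of_le_pi le_rfl (by nlinarith [pi_pos]) (by positivity)

theorem abs_signedArccos {x : ℝ} (hx : x ≠ 0) (t : ℝ) :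
    |signedArccos x t| = arccos t / (2 * π) := by
  rw [signedArccos, abs_mul, abs_div, abs_abs, div_self (abs_ne_zero.2 hx), one_mul,
    abs_of_nonneg (div_nonneg (arccos_nonneg t) two_pi_pos.le)]

theorem signedArccos_ne_zero {x t : ℝ} (hx : x ≠ 0) (ht : |t| < 1) : signedArccos x t ≠ 0 := by
  rw [← abs_ne_zero, abs_signedArccos hx]
  exact (div_pos (arccos_pos.2 (abs_lt.1 ht).2) two_pi_pos).ne'

theorem abs_signedArccos_lt {x t : ℝ} (hx : x ≠ 0) (ht : |t| < 1) :
    |signedArccos x t| < 1 / 2 := by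
  have h : arccos t < π := lt_of_le_of_ne (arccos_le_pi t) fun h => by
    rw [arccos_eq_pi] at h
    linarith [(abs_lt.1 ht).1]
  rw [abs_signedArccos hx, div_lt_iff₀ two_pi_pos]
  linarith

theorem signedArccos_signedArccos {x t : ℝ} (hx : x ≠ 0) (ht : |t| < 1) (t' : ℝ) :
    signedArccos (signedArccos x t) t' = signedArccos x t' := by
  have h : 0 < arccos t / (2 * π) := div_pos (arccos_pos.2 (abs_lt.1 ht).2) two_pi_pos
  rw [signedArccos, abs_signedArccos hx, signedArccos, mul_div_assoc, div_self h.ne', mul_one,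
    signedArccos]

theorem measurable_signedArccos : Measurable fun p : ℝ × ℝ => signedArccos p.1 p.2 := by
  unfold signedArccos
  have := continuous_arccos.measurable
  fun_prop

theorem differentiableAt_signedArccos {x t : ℝ} (hx : x ≠ 0) (ht : |t| < 1) :
    DifferentiableAt ℝ (fun p : ℝ × ℝ => signedArccos p.1 p.2) (x, t) := by
  have h1 : DifferentiableAt ℝ (fun p : ℝ × ℝ => |p.1|) (x, t) :=
    DifferentiableAt.comp (g := fun y : ℝ => |y|) (f := Prod.fst) (x, t) (differentiableAt_abs hx)
      differentiableAt_fst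
  have h2 : DifferentiableAt ℝ (fun p : ℝ × ℝ => arccos p.2) (x, t) :=
    DifferentiableAt.comp (g := arccos) (f := Prod.snd) (x, t)
      (differentiableAt_arccos.2 ⟨(abs_lt.1 ht).1.ne', (abs_lt.1 ht).2.ne⟩) differentiableAt_snd
  have h3 : DifferentiableAt ℝ (fun p : ℝ × ℝ => arccos p.2 / (2 * π)) (x, t) := by
    simpa only [div_eq_mul_inv] using h2.mul_const (2 * π)⁻¹
  have h4 : DifferentiableAt ℝ (fun p : ℝ × ℝ => p.1 / |p.1|) (x, t) := by
    simpa only [div_eq_mul_inv] using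
      DifferentiableAt.fun_mul differentiableAt_fst (h1.fun_inv (abs_ne_zero.2 hx))
  exact DifferentiableAt.fun_mul h4 h3

variable {m : ℕ}

/-- A fundamental domain for the torus. -/
def cube (n : ℕ) : Set (Fin n → ℝ) := univ.pi fun _ => Ioc (-(1 / 2)) (1 / 2)

/-- The points of the fundamental domain at which no cosine of a coordinate is `±1`. -/
def cubeCore (n : ℕ) : Set (Fin n → ℝ) := {x | ∀ i, x i ≠ 0 ∧ |x i| < 1 / 2}

theorem measurableSet_cube (n : ℕ) : MeasurableSet (cube n) :=
  MeasurableSet.univ_pi fun _ => measurableSet_Ioc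

theorem measurableSet_cubeCore (n : ℕ) : MeasurableSet (cubeCore n) := by
  unfold cubeCore
  measurability

theorem cubeCore_subset_cube (n : ℕ) : cubeCore n ⊆ cube n := fun x hx i _ =>
  ⟨by linarith [(abs_lt.1 (hx i).2).1], (abs_lt.1 (hx i).2).2.le⟩

theorem ae_mem_cubeCore (n : ℕ) : ∀ᵐ x ∂(volume.restrict (cube n)), x ∈ cubeCore n := by
  have h : ∀ (i : Fin n) (c : ℝ), ∀ᵐ x : Fin n → ℝ, x i ≠ c := fun i c => by
    rw [ae_iff, volume_pi]
    simpa using Measure.pi_hyperplane (fun _ : Fin n => (volume : Measure ℝ)) i c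
  rw [ae_restrict_iff' (measurableSet_cube n)]
  filter_upwards [ae_all_iff.2 fun i => h i 0, ae_all_iff.2 fun i => h i (1 / 2)]
    with x h0 h1 hx i
  obtain ⟨h2, h3⟩ := hx i (mem_univ i)
  exact ⟨h0 i, abs_lt.2 ⟨h2, lt_of_le_of_ne h3 (h1 i)⟩⟩

theorem volume_cube_ne_top (n : ℕ) : volume (cube n) ≠ ∞ := by
  rw [cube, volume_pi_pi]
  exact ENNReal.prod_ne_top fun _ _ => by simp

/-- The mean of the cosines. -/
def meanCos (x : Fin (m + 1) → ℝ) : ℝ := (∑ j, cos (2 * π * x j)) / (m + 1)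

theorem abs_meanCos_lt_one {x : Fin (m + 1) → ℝ} (hx : x ∈ cubeCore (m + 1)) :
    |meanCos x| < 1 := by
  rw [meanCos, abs_div, abs_of_pos (by positivity : (0 : ℝ) < m + 1), div_lt_one (by positivity)]
  calc |∑ j, cos (2 * π * x j)| ≤ ∑ j, |cos (2 * π * x j)| := Finset.abs_sum_le_sum_abs _ _
    _ < ∑ _j : Fin (m + 1), (1 : ℝ) :=
      Finset.sum_lt_sum_of_nonempty Finset.univ_nonempty fun j _ =>
        abs_cos_lt_one (hx j).1 (hx j).2
    _ = m + 1 := by simp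

theorem measurable_meanCos : Measurable (meanCos (m := m)) := by
  unfold meanCos; fun_prop

theorem differentiable_meanCos : Differentiable ℝ (meanCos (m := m)) := by
  unfold meanCos; fun_prop

theorem cubeCore_cons {a : ℝ} {x : Fin m → ℝ} :
    (Fin.cons a x : Fin (m + 1) → ℝ) ∈ cubeCore (m + 1) ↔
      (a ≠ 0 ∧ |a| < 1 / 2) ∧ x ∈ cubeCore m := by
  simp only [cubeCore, mem_ofPred_eq, Fin.forall_fin_succ, Fin.cons_zero, Fin.cons_succ]

/-- The symbol of the lattice embeds into the symbol of the rescaled line. -/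
theorem sum_cos_embeds_cos (m : ℕ) :
    Embeds (MulRel (fun x : Fin (m + 1) → ℝ => ∑ j, 2 * cos (2 * π * x j))
        (volume.restrict (cube (m + 1))))
      (MulRel (fun x : Fin (m + 1) → ℝ => (m + 1) * (2 * cos (2 * π * x 0)))
        (volume.restrict (cube (m + 1)))) := by
  let c : (Fin (m + 1) → ℝ) → ℝ := fun x =>
    (m + 1) * cos (2 * π * x 0) - ∑ j : Fin m, cos (2 * π * x j.succ)
  have hcm : Measurable c := by fun_prop
  have hcd : Differentiable ℝ c := by fun_prop
  let φ : (Fin (m + 1) → ℝ) → Fin (m + 1) → ℝ := fun x =>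
    Fin.cons (signedArccos (x 0) (c x)) (Fin.tail x)
  refine mulRel_embeds_of_differentiableOn volume (φ := φ) (t := cubeCore (m + 1) ∩ {x | |c x| < 1})
    ?_ (volume_cube_ne_top _) (volume_cube_ne_top _) ?_
    (inter_subset_left.trans (cubeCore_subset_cube _)) ?_ ?_ ?_
  · refine measurable_pi_iff.2 fun i => ?_
    refine Fin.cases ?_ (fun j => ?_) i
    · exact measurable_signedArccos.comp ((measurable_pi_apply 0).prodMk hcm)
    · exact measurable_pi_apply j.succ
  · exact (measurableSet_cubeCore _).inter (measurableSet_lt hcm.abs measurable_const)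
  · rintro x ⟨hx, hcx⟩
    refine (differentiableAt_pi.2 fun i => ?_).differentiableWithinAt
    refine Fin.cases ?_ (fun j => ?_) i
    · exact DifferentiableAt.comp (g := fun p : ℝ × ℝ => signedArccos p.1 p.2)
        (f := fun x => (x 0, c x)) x (differentiableAt_signedArccos (hx 0).1 hcx)
        (DifferentiableAt.prodMk (f₁ := fun x => x 0) (by fun_prop) (hcd x))
    · exact differentiableAt_apply j.succ x
  · filter_upwards [ae_mem_cubeCore (m + 1)] with y hy
    have hM := abs_meanCos_lt_one hy
    have hc : c (Fin.cons (signedArccos (y 0) (meanCos y)) (Fin.tail y)) = cos (2 * π * y 0) := by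
      simp only [c, Fin.cons_zero, Fin.cons_succ]
      rw [cos_signedArccos (hy 0).1 hM.le, meanCos, Fin.sum_univ_succ, mul_div_cancel₀ _
        (by positivity)]
      exact add_sub_cancel_right _ _
    refine ⟨Fin.cons (signedArccos (y 0) (meanCos y)) (Fin.tail y), ⟨?_, ?_⟩, ?_⟩
    · exact cubeCore_cons.2 ⟨⟨signedArccos_ne_zero (hy 0).1 hM, abs_signedArccos_lt (hy 0).1 hM⟩,
        fun j => hy j.succ⟩
    · rw [mem_ofPred_eq, hc]
      exact abs_cos_lt_one (hy 0).1 (hy 0).2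
    · simp only [φ, hc, Fin.cons_zero, Fin.tail_cons]
      rw [signedArccos_signedArccos (hy 0).1 hM, signedArccos_cos (hy 0).1 (hy 0).2,
        Fin.cons_self_tail]
  · rintro x ⟨hx, hcx⟩
    simp only [φ, Fin.sum_univ_succ, Fin.cons_zero, Fin.cons_succ]
    rw [cos_signedArccos (hx 0).1 (le_of_lt hcx), ← Finset.mul_sum]
    simp only [c, Fin.tail]
    ring

/-- The symbol of the rescaled line embeds into the symbol of the lattice. -/
theorem cos_embeds_sum_cos (m : ℕ) :
    Embeds (MulRel (fun x : Fin (m + 1) → ℝ => (m + 1) * (2 * cos (2 * π * x 0)))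
        (volume.restrict (cube (m + 1))))
      (MulRel (fun x : Fin (m + 1) → ℝ => ∑ j, 2 * cos (2 * π * x j))
        (volume.restrict (cube (m + 1)))) := by
  let ε : ℝ → ℝ := fun t => (1 - t ^ 2) / (m + 1)
  have hε : ∀ t, |t| < 1 → 0 < ε t := fun t ht =>
    div_pos (sub_pos.2 ((sq_lt_one_iff_abs_lt_one t).2 ht)) (by positivity)
  let ψ : (Fin (m + 1) → ℝ) → Fin (m + 1) → ℝ := fun x =>
    Fin.cons (signedArccos (x 0) (meanCos x))
      fun j => (cos (2 * π * x j.succ) - meanCos x) / ε (meanCos x)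
  refine mulRel_embeds_of_differentiableOn volume (φ := ψ) (t := cubeCore (m + 1))
    ?_ (volume_cube_ne_top _) (volume_cube_ne_top _) (measurableSet_cubeCore _)
    (cubeCore_subset_cube _) ?_ ?_ ?_
  · have := measurable_meanCos (m := m)
    refine measurable_pi_iff.2 fun i => ?_
    refine Fin.cases ?_ (fun j => ?_) i
    · exact measurable_signedArccos.comp ((measurable_pi_apply 0).prodMk measurable_meanCos)
    · simp only [ψ, Fin.cons_succ, ε]
      fun_prop
  · intro x hx
    have hM := abs_meanCos_lt_one hx
    have hd := differentiable_meanCos (m := m) x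
    refine (differentiableAt_pi.2 fun i => ?_).differentiableWithinAt
    refine Fin.cases ?_ (fun j => ?_) i
    · exact DifferentiableAt.comp (g := fun p : ℝ × ℝ => signedArccos p.1 p.2)
        (f := fun x => (x 0, meanCos x)) x (differentiableAt_signedArccos (hx 0).1 hM)
        (DifferentiableAt.prodMk (f₁ := fun x => x 0) (by fun_prop) hd)
    · have hεM := (hε _ hM).ne'
      simp only [ψ, Fin.cons_succ]
      have hεd : DifferentiableAt ℝ (fun x => ε (meanCos x)) x := by
        simpa only [ε, div_eq_mul_inv] using
          ((differentiableAt_const (1 : ℝ)).fun_sub (hd.fun_pow 2)).mul_const ((m : ℝ) + 1)⁻¹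
      have hnd : DifferentiableAt ℝ (fun x => cos (2 * π * x j.succ) - meanCos x) x := by
        fun_prop
      simpa only [div_eq_mul_inv] using hnd.fun_mul (hεd.fun_inv hεM)
  · filter_upwards [ae_mem_cubeCore (m + 1)] with u hu
    set c := cos (2 * π * u 0) with hc
    have hc1 : |c| < 1 := abs_cos_lt_one (hu 0).1 (hu 0).2
    have hεc := hε c hc1
    have hc2 : 1 - c ^ 2 < 2 * (1 - |c|) := by
      rw [← sq_abs]
      nlinarith [abs_nonneg c]
    have hεm : ε c * (m + 1) < 2 * (1 - |c|) := by
      simp only [ε]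
      rwa [div_mul_cancel₀ _ (by positivity)]
    let t : Fin (m + 1) → ℝ :=
      Fin.cons (c - ε c * ∑ j : Fin m, u j.succ) fun j => c + ε c * u j.succ
    have ht : ∀ i, |t i| < 1 := by
      have hsum : |∑ j : Fin m, u j.succ| ≤ m * (1 / 2) := by
        calc |∑ j : Fin m, u j.succ| ≤ ∑ j : Fin m, |u j.succ| := Finset.abs_sum_le_sum_abs _ _
          _ ≤ ∑ _j : Fin m, (1 / 2 : ℝ) := Finset.sum_le_sum fun j _ => (hu j.succ).2.le
          _ = m * (1 / 2) := by simp
      intro i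
      refine Fin.cases ?_ (fun j => ?_) i
      · simp only [t, Fin.cons_zero]
        calc |c - ε c * ∑ j : Fin m, u j.succ| ≤ |c| + |ε c * ∑ j : Fin m, u j.succ| := abs_sub _ _
          _ = |c| + ε c * |∑ j : Fin m, u j.succ| := by rw [abs_mul, abs_of_pos hεc]
          _ < 1 := by nlinarith
      · simp only [t, Fin.cons_succ]
        calc |c + ε c * u j.succ| ≤ |c| + |ε c * u j.succ| := abs_add_le _ _
          _ = |c| + ε c * |u j.succ| := by rw [abs_mul, abs_of_pos hεc]
          _ < 1 := by
            have := (hu j.succ).2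
            have hm : (0 : ℝ) ≤ m := by positivity
            nlinarith [mul_nonneg hεc.le hm]
    have hcos : ∀ i, cos (2 * π * signedArccos (u i) (t i)) = t i := fun i =>
      cos_signedArccos (hu i).1 (ht i).le
    have hmean : meanCos (fun i => signedArccos (u i) (t i)) = c := by
      rw [meanCos, div_eq_iff (by positivity)]
      simp only [hcos, t, Fin.sum_univ_succ, Fin.cons_zero, Fin.cons_succ, Finset.sum_add_distrib,
        ← Finset.mul_sum]
      simp
      ring
    refine ⟨fun i => signedArccos (u i) (t i), fun i => ⟨signedArccos_ne_zero (hu i).1 (ht i),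
      abs_signedArccos_lt (hu i).1 (ht i)⟩, ?_⟩
    ext i
    refine Fin.cases ?_ (fun j => ?_) i
    · simp only [ψ, hmean, Fin.cons_zero]
      rw [signedArccos_signedArccos (hu 0).1 (ht 0), signedArccos_cos (hu 0).1 (hu 0).2]
    · simp only [ψ, hmean, Fin.cons_succ, hcos]
      simp only [t, Fin.cons_succ]
      rw [add_sub_cancel_left, mul_div_cancel_left₀ _ hεc.ne']
  · intro x hx
    simp only [ψ, Fin.cons_zero]
    rw [cos_signedArccos (hx 0).1 (abs_meanCos_lt_one hx).le, ← Finset.mul_sum, meanCos]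
    field_simp

end Symbols

section Fourier

local notation "ℓ²(" ι ")" => lp (fun _ : ι => ℂ) 2

local instance unitAddCircleMeasureSpace : MeasureSpace UnitAddCircle := ⟨AddCircle.haarAddCircle⟩

local instance unitAddCircleIsAddHaarMeasure :
    Measure.IsAddHaarMeasure (volume : Measure UnitAddCircle) :=
  inferInstanceAs (Measure.IsAddHaarMeasure AddCircle.haarAddCircle)

local instance unitAddCircleIsProbabilityMeasure :
    IsProbabilityMeasure (volume : Measure UnitAddCircle) :=
  inferInstanceAs (IsProbabilityMeasure AddCircle.haarAddCircle)

open UnitAddTorus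

variable {n : ℕ}

theorem integrable_mFourier_mul (k : Fin n → ℤ) (h : Lp ℂ 2 (volume : Measure (UnitAddTorus (Fin n)))) :
    Integrable (fun t => mFourier k t * h t) volume := by
  have h1 : Integrable h volume := (Lp.memLp h).integrable (by norm_num)
  refine h1.bdd_mul (c := 1) (mFourier k).continuous.aestronglyMeasurable
    (Eventually.of_forall fun t => ?_)
  exact ((mFourier k).norm_coe_le_norm t).trans mFourier_norm.le

theorem mFourierBasis_repr_symm_lineOp (j : Fin n) (ξ : ℓ²(Fin n → ℤ)) :
    mFourierBasis.repr.symm (lineOp j ξ) =ᵐ[(volume : Measure (UnitAddTorus (Fin n)))] fun t =>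
      (mFourier (Pi.single j 1) t + mFourier (-Pi.single j 1) t) *
        mFourierBasis.repr.symm ξ t := by
  set h := mFourierBasis.repr.symm ξ with hh
  have hmem : MemLp (fun t => (mFourier (Pi.single j 1) t + mFourier (-Pi.single j 1) t) * h t) 2
      (volume : Measure (UnitAddTorus (Fin n))) := by
    refine MemLp.of_le_mul (c := 2) (Lp.memLp h) ?_ (Eventually.of_forall fun t => ?_)
    · exact ((mFourier (Pi.single j 1)).continuous.add
        (mFourier (-Pi.single j 1)).continuous).aestronglyMeasurable.mul (Lp.aestronglyMeasurable h)
    · rw [norm_mul]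
      refine mul_le_mul_of_nonneg_right ?_ (norm_nonneg _)
      refine (norm_add_le _ _).trans ?_
      have h1 : ∀ k : Fin n → ℤ, ‖mFourier k t‖ ≤ 1 := fun k =>
        ((mFourier k).norm_coe_le_norm t).trans mFourier_norm.le
      linarith [h1 (Pi.single j 1), h1 (-Pi.single j 1)]
  have key : mFourierBasis.repr (hmem.toLp _) = lineOp j ξ := by
    ext k
    have hc : ∀ k, ξ k = mFourierCoeff h k := fun k => by
      rw [← mFourierBasis_repr, hh, LinearIsometryEquiv.apply_symm_apply]
    rw [mFourierBasis_repr, lineOp_apply, hc, hc, mFourierCoeff, mFourierCoeff, mFourierCoeff,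
      ← integral_add]
    · refine integral_congr_ae ?_
      filter_upwards [hmem.coeFn_toLp] with t ht
      have e1 : -Function.update k j (k j - 1) = -k + Pi.single j 1 := by
        ext i
        by_cases hi : i = j
        · subst hi; simp; ring
        · simp [hi]
      have e2 : -Function.update k j (k j + 1) = -k + -Pi.single j 1 := by
        ext i
        by_cases hi : i = j
        · subst hi; simp; ring
        · simp [hi]
      rw [ht, e1, e2, mFourier_add, mFourier_add]
      simp only [smul_eq_mul]
      ring
    · exact integrable_mFourier_mul _ h
    · exact integrable_mFourier_mul _ h
  rw [← key, LinearIsometryEquiv.symm_apply_apply]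
  exact hmem.coeFn_toLp

theorem exists_measurePreserving_torus (n : ℕ) :
    ∃ s : UnitAddTorus (Fin n) → Fin n → ℝ,
      MeasurePreserving s volume (volume.restrict (cube n)) ∧ (∀ t i, (s t i : UnitAddCircle) = t i) ∧
      ∀ x ∈ cube n, s (fun i => (x i : UnitAddCircle)) = x := by
  let a : Fin n → ℝ := fun _ => -(1 / 2)
  have hcube : {x : Fin n → ℝ | ∀ i, x i ∈ Ioc (a i) (a i + 1)} = cube n := by
    have : (-(1 / 2) + 1 : ℝ) = 1 / 2 := by norm_num
    ext x
    simp only [cube, a, this, Set.mem_pi, Set.mem_ofPred_eq, mem_univ, true_implies]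
  have h1 := measurePreserving_equivPiIoc a
  have h2 : MeasurePreserving (Subtype.val : {x : Fin n → ℝ // ∀ i, x i ∈ Ioc (a i) (a i + 1)} → _)
      (Measure.comap Subtype.val volume) (volume.restrict (cube n)) := by
    rw [← hcube]
    refine measurePreserving_subtype_coe ?_
    change MeasurableSet {x : Fin n → ℝ | ∀ i, x i ∈ Ioc (a i) (a i + 1)}
    rw [hcube]
    exact measurableSet_cube n
  refine ⟨fun t => (measurableEquivPiIoc a t).1, h2.comp h1, fun t i => ?_, fun x hx => ?_⟩
  · exact AddCircle.coe_equivIoc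
  · rw [← hcube] at hx
    ext i
    exact AddCircle.equivIoc_coe_of_mem (hx i)

/-- The Fourier transform diagonalizes the adjacency operators of the lines. -/
theorem exists_fourier (n : ℕ) :
    ∃ U : ℓ²(Fin n → ℤ) ≃ₗᵢ[ℂ] Lp ℂ 2 (volume.restrict (cube n)), ∀ j ξ,
      U (lineOp j ξ) =ᵐ[volume.restrict (cube n)] fun x =>
        ((2 * Real.cos (2 * Real.pi * x j) : ℝ) : ℂ) * U ξ x := by
  obtain ⟨s, hs, hs1, hs2⟩ := exists_measurePreserving_torus n
  let p : (Fin n → ℝ) → UnitAddTorus (Fin n) := fun x i => (x i : UnitAddCircle)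
  have hpm : Measurable p := measurable_pi_iff.2 fun i =>
    AddCircle.measurable_mk'.comp (measurable_pi_apply i)
  have hps : p ∘ s = id := funext fun t => funext fun i => hs1 t i
  have hp : MeasurePreserving p (volume.restrict (cube n)) volume :=
    ⟨hpm, by rw [← hs.map_eq, Measure.map_map hpm hs.measurable, hps, Measure.map_id]⟩
  let W := Lp.compMeasurePreservingₗᵢ ℂ (E := ℂ) (p := 2) p hp
  have hW : ∀ h, W h =ᵐ[volume.restrict (cube n)] h ∘ p := fun h =>
    Lp.coeFn_compMeasurePreserving h hp
  have hWs : Function.Surjective W := fun g => by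
    refine ⟨Lp.compMeasurePreserving s hs g, ?_⟩
    ext1
    refine (hW _).trans
      ((hp.quasiMeasurePreserving.ae_eq_comp (Lp.coeFn_compMeasurePreserving g hs)).trans ?_)
    rw [EventuallyEq, ae_restrict_iff' (measurableSet_cube n)]
    exact Eventually.of_forall fun x hx => congrArg g (hs2 x hx)
  refine ⟨mFourierBasis.repr.symm.trans (LinearIsometryEquiv.ofSurjective W hWs), fun j ξ => ?_⟩
  change W (mFourierBasis.repr.symm (lineOp j ξ)) =ᵐ[_] fun x =>
    _ * W (mFourierBasis.repr.symm ξ) x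
  filter_upwards [hW (mFourierBasis.repr.symm (lineOp j ξ)), hW (mFourierBasis.repr.symm ξ),
    hp.quasiMeasurePreserving.ae_eq_comp (mFourierBasis_repr_symm_lineOp j ξ)] with x h1 h2 h3
  rw [h1, h2, h3]
  simp only [Function.comp_apply]
  congr 1
  rw [mFourier_neg, mFourier_single, fourier_coe_apply, ← Complex.exp_conj]
  push_cast
  rw [Complex.two_cos]
  congr 2
  · simp; ring
  · simp [map_ofNat]; ring

end Fourier

section Conclusion

open ContinuousLinearMap

local notation "ℓ²(" ι ")" => lp (fun _ : ι => ℂ) 2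

theorem coeFn_sum {X ι : Type*} [MeasurableSpace X] {μ : Measure X} (s : Finset ι) (h : ι → Lp ℂ 2 μ)
    {g : ι → X → ℂ} (hg : ∀ i, h i =ᵐ[μ] g i) : ⇑(∑ i ∈ s, h i) =ᵐ[μ] fun x => ∑ i ∈ s, g i x := by
  classical
  induction s using Finset.induction_on with
  | empty => exact Lp.coeFn_zero ℂ 2 μ
  | insert i s hi ih =>
    simp only [Finset.sum_insert hi]
    filter_upwards [Lp.coeFn_add (h i) (∑ i ∈ s, h i), hg i, ih] with x h1 h2 h3
    rw [h1, Pi.add_apply, h2, h3]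

theorem embeds_of_forall_ae_eq {H X : Type*} [NormedAddCommGroup H] [InnerProductSpace ℂ H]
    [MeasurableSpace X] {μ : Measure X} {T : H →L[ℂ] H} {f : X → ℝ} (U : H ≃ₗᵢ[ℂ] Lp ℂ 2 μ)
    (hU : ∀ ξ, U (T ξ) =ᵐ[μ] fun x => (f x : ℂ) * U ξ x) :
    Embeds (fun x y => T x = y) (MulRel f μ) ∧ Embeds (MulRel f μ) (fun x y => T x = y) := by
  refine ⟨⟨U.toLinearIsometry, ?_⟩, ⟨U.symm.toLinearIsometry, fun h h' hh => ?_⟩⟩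
  · rintro ξ _ rfl
    exact hU ξ
  · refine U.injective (Lp.ext ?_)
    have h1 := hU (U.symm h)
    simp only [LinearIsometryEquiv.coe_toLinearIsometry, LinearIsometryEquiv.apply_symm_apply]
      at h1 ⊢
    exact h1.trans (EventuallyEq.symm hh)

theorem sum_lineOp_embeds (m : ℕ) :
    let T : ℓ²(Fin (m + 1) → ℤ) →L[ℂ] ℓ²(Fin (m + 1) → ℤ) := ∑ j, lineOp j
    let S : ℓ²(Fin (m + 1) → ℤ) →L[ℂ] ℓ²(Fin (m + 1) → ℤ) := ((m + 1 : ℕ) : ℂ) • lineOp 0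
    Embeds (fun x y => T x = y) (fun x y => S x = y) ∧
      Embeds (fun x y => S x = y) (fun x y => T x = y) := by
  intro T S
  obtain ⟨U, hU⟩ := exists_fourier (m + 1)
  have hT := embeds_of_forall_ae_eq (T := T)
    (f := fun x => ∑ j, 2 * Real.cos (2 * Real.pi * x j)) U fun ξ => by
      simp only [T, sum_apply, map_sum]
      refine (coeFn_sum _ _ fun j => hU j ξ).trans (Eventually.of_forall fun x => ?_)
      simp only [Complex.ofReal_sum, Finset.sum_mul]
  have hS := embeds_of_forall_ae_eq (T := S)
    (f := fun x => (m + 1) * (2 * Real.cos (2 * Real.pi * x 0))) U fun ξ => by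
      simp only [S, smul_apply, map_smul]
      filter_upwards [Lp.coeFn_smul ((m + 1 : ℕ) : ℂ) (U (lineOp 0 ξ)), hU 0 ξ] with x h1 h2
      rw [h1, Pi.smul_apply, h2, smul_eq_mul]
      push_cast
      ring
  exact ⟨(hT.1.trans (sum_cos_embeds_cos m)).trans hS.2,
    (hS.1.trans (cos_embeds_sum_cos m)).trans hT.2⟩

end Conclusion

/-- The lattice `L_d` and the rooted regular tree of branching degree `d²` are cospectral:
their adjacency operators are unitarily equivalent. -/
theorem stmt_19 (d : ℕ) (hd : 2 ≤ d)
    (A : lp (fun _ : Fin d → ℤ => ℂ) 2 →L[ℂ] lp (fun _ : Fin d → ℤ => ℂ) 2)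
    (hA : ∀ (ξ : lp (fun _ : Fin d → ℤ => ℂ) 2) (u : Fin d → ℤ),
      A ξ u = ∑ j : Fin d,
        (ξ (Function.update u j (u j - 1)) + ξ (Function.update u j (u j + 1))))
    (B : lp (fun _ : List (Fin (d ^ 2)) => ℂ) 2 →L[ℂ] lp (fun _ : List (Fin (d ^ 2)) => ℂ) 2)
    (hB : ∀ (ξ : lp (fun _ : List (Fin (d ^ 2)) => ℂ) 2) (v : List (Fin (d ^ 2))),
      B ξ v = (if v = [] then 0 else ξ v.tail) + ∑ a : Fin (d ^ 2), ξ (a :: v)) :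
    ∃ U : lp (fun _ : Fin d → ℤ => ℂ) 2 ≃ₗᵢ[ℂ] lp (fun _ : List (Fin (d ^ 2)) => ℂ) 2,
      ∀ ξ, U (A ξ) = B (U ξ) := by
  classical
  obtain ⟨m, rfl⟩ : ∃ m, d = m + 2 := ⟨d - 2, by omega⟩
  have hA' : A = ∑ j, lineOp j := by
    ext ξ u
    rw [hA, sum_apply, lp.coeFn_sum, Finset.sum_apply]
    simp only [lineOp_apply]
  have hB' : B = childSum (Fin ((m + 2) ^ 2)) +
      ContinuousLinearMap.adjoint (childSum (Fin ((m + 2) ^ 2))) := by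
    ext ξ v
    rw [hB, add_apply, lp.coeFn_add, Pi.add_apply, childSum_apply, add_comm]
    congr 1
    cases v with
    | nil => rw [if_pos rfl, adjoint_childSum_apply_nil]
    | cons a v => rw [if_neg (List.cons_ne_nil a v), adjoint_childSum_apply_cons, List.tail_cons]
  have hα : Fintype.card (Fin ((m + 2) ^ 2)) = (m + 2) ^ 2 := Fintype.card_fin _
  obtain ⟨h1, h2⟩ := sum_lineOp_embeds (m + 1)
  subst hA' hB'
  refine exists_unitary_of_embeds ?_ adjoint_tree (h1.trans (lineOp_embeds_tree (m + 1) hd hα))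
    ((tree_embeds_lineOp m (by omega) hα).trans h2)
  simp only [map_sum, adjoint_lineOp]
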